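/- arXiv:0907.4217 — 2 statements merged into one kernel-verified Lean document; each statement's English description precedes it below -/
import Mathlib

section
/- For p = 1 and for p = n − 1, a real (p,p)-covector on an n-dimensional complex vector space is weakly positive if and only if it is strongly positive. -/
open ComplexConjugate

noncomputable section

/-- `ℂⁿ`. -/
abbrev Vec (n : ℕ) := Fin n → ℂ

/-- `η` is a `k`-covector on `ℂⁿ` (viewed as a real vector space): it is
`ℝ`-multilinear and alternating in its `k` arguments. -/
def IsCov (n k : ℕ) (η : (Fin k → Vec n) → ℂ) : Prop :=
  (∀ (v : Fin k → Vec n) (i : Fin k) (c : ℝ) (x : Vec n),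
      η (Function.update v i (c • x)) = (c : ℂ) * η (Function.update v i x)) ∧
  (∀ (v : Fin k → Vec n) (i : Fin k) (x y : Vec n),
      η (Function.update v i (x + y)) =
        η (Function.update v i x) + η (Function.update v i y)) ∧
  (∀ (v : Fin k → Vec n) (i j : Fin k), i ≠ j → v i = v j → η v = 0)

/-- A `2p`-covector has type `(p,p)` iff it scales by `|c|^{2p}` under complex scaling
of all its arguments. -/
def IsTypePP (n p : ℕ) (η : (Fin (2 * p) → Vec n) → ℂ) : Prop :=
  ∀ (c : ℂ) (v : Fin (2 * p) → Vec n),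
    η (fun i => c • v i) = (c * conj c) ^ p * η v

/-- A `(p,p)`-covector is real iff it takes real values. -/
def IsRealPP (n p : ℕ) (η : (Fin (2 * p) → Vec n) → ℂ) : Prop :=
  ∀ v : Fin (2 * p) → Vec n, conj (η v) = η v

/-- The tuple `(x₁, I x₁, x₂, I x₂, ..., x_p, I x_p)` on which weak positivity is
tested. -/
def pairUp (n p : ℕ) (x : Fin p → Vec n) : Fin (2 * p) → Vec n :=
  fun i => if i.1 % 2 = 0 then x ⟨i.1 / 2, by have := i.2; omega⟩
    else Complex.I • x ⟨i.1 / 2, by have := i.2; omega⟩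

/-- A `(p,p)`-covector `η` is weakly positive iff its (suitably normalized) evaluation
on every complex `p`-plane, i.e. on every tuple `(x₁, I x₁, ..., x_p, I x_p)`, is a
nonnegative real number. -/
def WeaklyPos (n p : ℕ) (η : (Fin (2 * p) → Vec n) → ℂ) : Prop :=
  ∀ x : Fin p → Vec n, 0 ≤ (η (pairUp n p x)).re ∧ (η (pairUp n p x)).im = 0

/-- The positive simple `(1,1)`-covector `√-1 ξ ∧ ξ̄` associated with a `ℂ`-linear
functional `ξ`. -/
def omega1 (n : ℕ) (ξ : Vec n →ₗ[ℂ] ℂ) : (Fin 2 → Vec n) → ℂ :=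
  fun v => Complex.I * (ξ (v 0) * conj (ξ (v 1)) - ξ (v 1) * conj (ξ (v 0)))

/-- The wedge product of a family of `p` two-covectors, as a `2p`-covector. -/
def wedgeFam (n p : ℕ) (ω : Fin p → ((Fin 2 → Vec n) → ℂ)) :
    (Fin (2 * p) → Vec n) → ℂ :=
  fun v => (1 / (2 ^ p : ℂ)) * ∑ σ : Equiv.Perm (Fin (2 * p)),
    ((Equiv.Perm.sign σ : ℤ) : ℂ) * ∏ k : Fin p,
      ω k ![v (σ ⟨2 * k.1, by have := k.2; omega⟩),
            v (σ ⟨2 * k.1 + 1, by have := k.2; omega⟩)]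

/-- A `(p,p)`-covector is strongly positive iff it is a finite nonnegative linear
combination of the simple positive covectors
`(√-1)^{p²} ξ₁ ∧ ξ̄₁ ∧ ⋯ ∧ ξ_p ∧ ξ̄_p`. -/
def StronglyPos (n p : ℕ) (η : (Fin (2 * p) → Vec n) → ℂ) : Prop :=
  ∃ (N : ℕ) (a : Fin N → ℝ) (ξ : Fin N → Fin p → (Vec n →ₗ[ℂ] ℂ)),
    (∀ s : Fin N, 0 ≤ a s) ∧
    ∀ v : Fin (2 * p) → Vec n,
      η v = ∑ s : Fin N, (a s : ℂ) * wedgeFam n p (fun k => omega1 n (ξ s k)) v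

/-- The wedge product of a `j`-covector and a `k`-covector. -/
def wedge (n j k : ℕ) (α : (Fin j → Vec n) → ℂ) (β : (Fin k → Vec n) → ℂ) :
    (Fin (j + k) → Vec n) → ℂ :=
  fun v => (1 / ((j.factorial * k.factorial : ℕ) : ℂ)) *
    ∑ σ : Equiv.Perm (Fin (j + k)),
      ((Equiv.Perm.sign σ : ℤ) : ℂ) *
        (α (fun i => v (σ (Fin.castAdd k i))) * β (fun i => v (σ (Fin.natAdd j i))))

/-- The standard basis of `ℂⁿ`. -/
def stdBasis (n : ℕ) : Fin n → Vec n := fun i => Pi.single i 1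

/-- The identification `Λ^{n,n} ≅ ℝ` by evaluation against the standard positive
volume element. -/
def topEval (n : ℕ) (η : (Fin (2 * n) → Vec n) → ℂ) : ℝ :=
  (η (pairUp n n (stdBasis n))).re

/-- The duality pairing of a `(p,p)`-covector with an `(n-p,n-p)`-covector: wedge them
and evaluate in `Λ^{n,n} ≅ ℝ`. -/
def topPair (n p : ℕ) (hp : p ≤ n) (η : (Fin (2 * p) → Vec n) → ℂ)
    (β : (Fin (2 * (n - p)) → Vec n) → ℂ) : ℝ :=
  topEval n fun v =>
    wedge n (2 * p) (2 * (n - p)) η β fun i => v (Fin.cast (by omega) i)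

end

noncomputable section

def eqv (p : ℕ) : Fin p × Fin 2 ≃ Fin (2 * p) :=
  finProdFinEquiv.trans (finCongr (Nat.mul_comm p 2))

lemma eqv_val (p : ℕ) (i : Fin p × Fin 2) : (eqv p i).1 = i.2.1 + 2 * i.1.1 := rfl

def DD {n p : ℕ} (ξ ζ : Fin p → Vec n → ℂ) (v : Fin (2 * p) → Vec n) : ℂ :=
  Matrix.det (Matrix.of fun (i j : Fin p × Fin 2) =>
    if i.2 = 0 then ξ i.1 (v (eqv p j)) else conj (ζ i.1 (v (eqv p j))))

lemma wedgeFam_eq (n p : ℕ) (ξ : Fin p → (Vec n →ₗ[ℂ] ℂ)) (v : Fin (2 * p) → Vec n) :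
    wedgeFam n p (fun k => omega1 n (ξ k)) v
      = Complex.I ^ p * DD (fun k => ξ k) (fun k => ξ k) v := by
  set A : Fin p × Fin 2 → Fin p × Fin 2 → ℂ := fun i j =>
    if i.2 = 0 then ξ i.1 (v (eqv p j)) else conj (ξ i.1 (v (eqv p j))) with hA
  have hD : DD (fun k => ξ k) (fun k => ξ k) v
      = ∑ σ : Equiv.Perm (Fin p × Fin 2), ((Equiv.Perm.sign σ : ℤ) : ℂ) * ∏ i, A i (σ i) := by
    unfold DD
    rw [← Matrix.det_transpose, Matrix.det_apply']
    rfl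
  have hW : wedgeFam n p (fun k => omega1 n (ξ k)) v
      = (1 / (2 ^ p : ℂ)) * ∑ σ : Equiv.Perm (Fin p × Fin 2), ((Equiv.Perm.sign σ : ℤ) : ℂ) *
        ∏ k : Fin p, (Complex.I * ∑ t : Equiv.Perm (Fin 2), ((Equiv.Perm.sign t : ℤ) : ℂ) *
          ∏ b : Fin 2, A (k, b) (σ (k, t b))) := by
    unfold wedgeFam
    congr 1
    rw [← (eqv p).permCongr.sum_comp]
    refine Finset.sum_congr rfl fun σ _ => ?_
    rw [Equiv.Perm.sign_permCongr]
    congr 1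
    refine Finset.prod_congr rfl fun k _ => ?_
    have h0 : (eqv p).symm ⟨2 * k.1, by have := k.2; omega⟩ = (k, 0) := by
      rw [Equiv.symm_apply_eq]; ext; simp [eqv_val]
    have h1 : (eqv p).symm ⟨2 * k.1 + 1, by have := k.2; omega⟩ = (k, 1) := by
      rw [Equiv.symm_apply_eq]; ext; simp [eqv_val]; ring
    rw [Equiv.permCongr_apply, Equiv.permCongr_apply, h0, h1]
    have hu : (Finset.univ : Finset (Equiv.Perm (Fin 2))) = {1, Equiv.swap 0 1} := by decide
    rw [hu, Finset.sum_pair (by decide)]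
    simp [omega1, hA]
    ring
  rw [hW, hD]
  have key : ∀ t : Fin p → Equiv.Perm (Fin 2),
      ∑ σ : Equiv.Perm (Fin p × Fin 2), ((Equiv.Perm.sign σ : ℤ) : ℂ) *
        ∏ k, (((Equiv.Perm.sign (t k) : ℤ) : ℂ) * ∏ b : Fin 2, A (k, b) (σ (k, t k b)))
      = ∑ σ : Equiv.Perm (Fin p × Fin 2), ((Equiv.Perm.sign σ : ℤ) : ℂ) * ∏ i, A i (σ i) := by
    intro t
    rw [← Equiv.sum_comp (Equiv.mulRight (Equiv.prodCongrRight t : Equiv.Perm (Fin p × Fin 2)))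
      (fun σ : Equiv.Perm (Fin p × Fin 2) => ((Equiv.Perm.sign σ : ℤ) : ℂ) * ∏ i, A i (σ i))]
    refine Finset.sum_congr rfl fun σ _ => ?_
    rw [Finset.prod_mul_distrib, Fintype.prod_prod_type]
    simp only [Equiv.coe_mulRight, Equiv.Perm.sign_mul, Equiv.Perm.sign_prodCongrRight]
    push_cast
    rw [mul_assoc]
    simp
  simp_rw [Finset.prod_mul_distrib, Finset.prod_univ_sum, Fintype.piFinset_univ]
  simp_rw [Finset.prod_const, Finset.card_univ, Fintype.card_fin, mul_left_comm _ (Complex.I ^ p),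
    ← Finset.mul_sum]
  simp_rw [Finset.mul_sum (s := (Finset.univ : Finset (Fin p → Equiv.Perm (Fin 2))))]
  rw [Finset.sum_comm, Finset.sum_congr rfl fun t _ => key t]
  simp [Fintype.card_perm]
  field_simp

lemma DD_pairUp {n p : ℕ} (ξ ζ : Fin p → Vec n → ℂ)
    (hξ : ∀ k x, ξ k (Complex.I • x) = Complex.I * ξ k x)
    (hζ : ∀ k x, ζ k (Complex.I • x) = Complex.I * ζ k x) (x : Fin p → Vec n) :
    DD ξ ζ (pairUp n p x) = (-2 * Complex.I) ^ p *
      ((Matrix.of fun k l => ξ k (x l)).det * conj (Matrix.of fun k l => ζ k (x l)).det) := by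
  have hp : ∀ j : Fin p × Fin 2, pairUp n p x (eqv p j)
      = if j.2 = 0 then x j.1 else Complex.I • x j.1 := by
    rintro ⟨l, c⟩
    unfold pairUp
    have hv := eqv_val p (l, c)
    have h2 : (eqv p (l, c)).1 / 2 = l.1 := by rw [hv]; simp only; omega
    have h3 : (eqv p (l, c)).1 % 2 = c.1 := by rw [hv]; simp only; omega
    have h4 : ∀ h, (⟨(eqv p (l, c)).1 / 2, h⟩ : Fin p) = l := fun h => Fin.ext h2
    have h5 : c.1 = 0 ↔ c = 0 := by rw [Fin.ext_iff]; rfl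
    rw [h4, h3]
    simp only [h5]
  let B : Fin 2 → Matrix (Fin p) (Fin p) ℂ := ![Matrix.of fun k l => ξ k (x l),
    Matrix.of fun k l => conj (ζ k (x l))]
  let C : Matrix (Fin 2) (Fin 2) ℂ := !![1, Complex.I; 1, -Complex.I]
  have hM : (Matrix.of fun (i j : Fin p × Fin 2) =>
    if i.2 = 0 then ξ i.1 (pairUp n p x (eqv p j)) else conj (ζ i.1 (pairUp n p x (eqv p j))))
      = Matrix.blockDiagonal B * Matrix.kronecker 1 C := by
    ext ⟨k, b⟩ ⟨l, c⟩
    rw [Matrix.mul_apply, Fintype.sum_prod_type]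
    simp only [Matrix.of_apply, hp, Matrix.blockDiagonal_apply, Matrix.kronecker,
      Matrix.kroneckerMap_apply, Matrix.one_apply, ite_mul, zero_mul, one_mul, mul_ite, mul_zero]
    rw [Finset.sum_comm]
    simp only [Finset.sum_ite_eq, Finset.sum_ite_eq', Finset.mem_univ, if_true]
    fin_cases b <;> fin_cases c <;> simp [B, C, hξ, hζ, mul_comm]
  unfold DD
  rw [hM, Matrix.det_mul, Matrix.det_blockDiagonal, Matrix.kronecker, Matrix.det_kronecker]
  have hC : C.det = -2 * Complex.I := by simp [C, Matrix.det_fin_two]; ring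
  have hB : (Matrix.of fun k l => conj (ζ k (x l))).det
      = conj (Matrix.of fun k l => ζ k (x l)).det := by
    rw [RingHom.map_det]; rfl
  simp [hC, B, hB]
  ring

lemma wedgeFam_pairUp (n p : ℕ) (ξ : Fin p → (Vec n →ₗ[ℂ] ℂ)) (x : Fin p → Vec n) :
    wedgeFam n p (fun k => omega1 n (ξ k)) (pairUp n p x)
      = 2 ^ p * (Complex.normSq (Matrix.of fun k l => ξ k (x l)).det : ℂ) := by
  rw [wedgeFam_eq, DD_pairUp _ _ (by simp) (by simp), ← mul_assoc, ← mul_pow, Complex.mul_conj]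
  congr 2
  linear_combination (-2) * Complex.I_sq

lemma strong_weak (n p : ℕ) (η : (Fin (2 * p) → Vec n) → ℂ) (h : StronglyPos n p η) :
    WeaklyPos n p η := by
  obtain ⟨N, a, ξ, ha, h⟩ := h
  intro x
  have : η (pairUp n p x) = ((∑ s, a s * (2 ^ p *
    Complex.normSq (Matrix.of fun k l => ξ s k (x l)).det) : ℝ) : ℂ) := by
    rw [h]; push_cast
    refine Finset.sum_congr rfl fun s _ => ?_
    rw [wedgeFam_pairUp]
  rw [this]
  refine ⟨?_, Complex.ofReal_im _⟩
  rw [Complex.ofReal_re]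
  exact Finset.sum_nonneg fun s _ => mul_nonneg (ha s)
    (mul_nonneg (by positivity) (Complex.normSq_nonneg _))


def cj (b : Fin 2) (z : ℂ) : ℂ := if b = 0 then z else conj z

def pf {n k : ℕ} (f : Fin k → Fin n × Fin 2) : (Fin k → Vec n) → ℂ :=
  fun v => ∏ i, cj (f i).2 (v i (f i).1)

def covMul {n k : ℕ} {η : (Fin k → Vec n) → ℂ} (h : IsCov n k η) :
    AlternatingMap ℝ (Vec n) ℂ (Fin k) where
  toFun := η
  map_update_add' := by
    intro inst v i x y
    have : inst = instDecidableEqFin k := Subsingleton.elim _ _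
    subst this
    exact h.2.1 v i x y
  map_update_smul' := by
    intro inst v i c x
    have : inst = instDecidableEqFin k := Subsingleton.elim _ _
    subst this
    rw [h.1 v i c x]; simp
  map_eq_zero_of_eq' := fun v i j hv hij => h.2.2 v i j hij hv

lemma cov_span {n k : ℕ} {η : (Fin k → Vec n) → ℂ} (h : IsCov n k η) :
    η ∈ Submodule.span ℂ (Set.range (pf : (Fin k → Fin n × Fin 2) → _)) := by
  let r : Fin n × Fin 2 → Vec n → ℝ := fun j x => if j.2 = 0 then (x j.1).re else (x j.1).im
  let bb : Fin n × Fin 2 → Vec n := fun j => Pi.single j.1 (if j.2 = 0 then 1 else Complex.I)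
  let γ : Fin 2 → Fin 2 → ℂ := ![![1/2, 1/2], ![-Complex.I/2, Complex.I/2]]
  have hx : ∀ x : Vec n, x = ∑ j, r j x • bb j := by
    intro x
    rw [Fintype.sum_prod_type]
    ext a
    simp only [Fin.sum_univ_two, Finset.sum_apply, Pi.add_apply, Pi.smul_apply, bb, r,
      Pi.single_apply]
    simp [Finset.sum_add_distrib]
  have hr : ∀ j x, (r j x : ℂ) = ∑ c, γ j.2 c * cj c (x j.1) := by
    rintro ⟨a, b⟩ x
    fin_cases b
    · simp [r, γ, cj, Fin.sum_univ_two, Complex.re_eq_add_conj]; ring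
    · simp [r, γ, cj, Fin.sum_univ_two, Complex.im_eq_sub_conj]; field_simp
      linear_combination ((x a) - conj (x a)) * Complex.I_sq
  have hη : η = ∑ f : Fin k → Fin n × Fin 2, ∑ g : Fin k → Fin 2,
      (η (fun i => bb (f i)) * ∏ i, γ (f i).2 (g i)) • pf (fun i => ((f i).1, g i)) := by
    funext v
    have h1 : η v = covMul h (fun i => ∑ j, r j (v i) • bb j) := by
      simp_rw [← hx]; rfl
    rw [h1]
    have h2 := (covMul h).toMultilinearMap.map_sum (fun i j => r j (v i) • bb j)
    rw [show (covMul h) (fun i => ∑ j, r j (v i) • bb j)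
      = (covMul h).toMultilinearMap (fun i => ∑ j, r j (v i) • bb j) from rfl, h2]
    rw [Finset.sum_apply]
    refine Finset.sum_congr rfl fun f _ => ?_
    rw [(covMul h).toMultilinearMap.map_smul_univ (fun i => r (f i) (v i)) (fun i => bb (f i))]
    rw [show (covMul h).toMultilinearMap (fun i => bb (f i)) = η (fun i => bb (f i)) from rfl]
    rw [Complex.real_smul]
    push_cast
    simp_rw [hr, Finset.prod_univ_sum, Fintype.piFinset_univ, Finset.prod_mul_distrib]
    rw [Finset.sum_apply, Finset.sum_mul]
    refine Finset.sum_congr rfl fun g _ => ?_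
    simp [pf]; ring
  rw [hη]
  exact Submodule.sum_mem _ fun f _ => Submodule.sum_mem _ fun g _ =>
    Submodule.smul_mem _ _ (Submodule.subset_span ⟨_, rfl⟩)

def cnt {n k : ℕ} (f : Fin k → Fin n × Fin 2) (b : Fin 2) : ℕ :=
  Fintype.card {i // (f i).2 = b}

lemma cnt_add {n k : ℕ} (f : Fin k → Fin n × Fin 2) : cnt f 0 + cnt f 1 = k := by
  have := Fintype.card_congr (Equiv.sigmaFiberEquiv (fun i => (f i).2))
  rw [Fintype.card_sigma, Fin.sum_univ_two] at this
  simpa [cnt] using this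

lemma pf_smul {n k : ℕ} (f : Fin k → Fin n × Fin 2) (c : ℂ) (v : Fin k → Vec n) :
    pf f (fun i => c • v i) = (c ^ cnt f 0 * conj c ^ cnt f 1) * pf f v := by
  have h1 : pf f (fun i => c • v i) = (∏ i, cj (f i).2 c) * pf f v := by
    unfold pf
    rw [← Finset.prod_mul_distrib]
    refine Finset.prod_congr rfl fun i _ => ?_
    unfold cj; split_ifs <;> simp
  rw [h1]
  congr 1
  rw [← (Equiv.sigmaFiberEquiv (fun i => (f i).2)).prod_comp, Fintype.prod_sigma, Fin.prod_univ_two]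
  have h2 : ∀ b, ∏ y : {i // (f i).2 = b}, cj (f ((Equiv.sigmaFiberEquiv fun i => (f i).2) ⟨b, y⟩)).2 c
      = cj b c ^ cnt f b := by
    intro b
    rw [Finset.prod_congr rfl (g := fun _ => cj b c)]
    · simp [cnt]
    · rintro ⟨i, hi⟩ _
      simp [hi]
  rw [h2, h2]
  simp [cj]

lemma cov_det {n p : ℕ} {η : (Fin (2 * p) → Vec n) → ℂ} (h : IsCov n (2 * p) η)
    (ht : IsTypePP n p η) :
    ∃ c : (Fin (2 * p) → Fin n × Fin 2) → ℂ, (∀ f, cnt f 0 ≠ p → c f = 0) ∧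
      ∀ v, η v = ∑ f, c f * Matrix.det (Matrix.of fun i j => cj (f i).2 (v j (f i).1)) := by
  obtain ⟨c, hc⟩ := (Submodule.mem_span_range_iff_exists_fun ℂ).1 (cov_span h)
  have hc' : ∀ v, η v = ∑ f, c f * pf f v := by
    intro v; rw [← hc]; simp [Finset.sum_apply]
  set N := 2 * p + 1 with hN
  obtain ⟨ζ, hζ⟩ : ∃ ζ : ℂ, IsPrimitiveRoot ζ N :=
    ⟨_, Complex.isPrimitiveRoot_exp N (by omega)⟩
  have hn : ‖ζ‖ = 1 := hζ.norm'_eq_one (by omega)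
  have hcc : ζ * conj ζ = 1 := by rw [Complex.mul_conj, Complex.normSq_eq_norm_sq, hn]; simp
  let w : (Fin (2 * p) → Fin n × Fin 2) → ℂ := fun f => ζ ^ cnt f 0 * conj ζ ^ cnt f 1
  have hw : ∀ f, cnt f 0 ≠ p → ∑ j ∈ Finset.range N, w f ^ j = 0 := by
    intro f hf
    have hadd := cnt_add f
    have hne : w f ≠ 1 := by
      intro h1
      have : ζ ^ cnt f 0 = ζ ^ cnt f 1 := by
        calc ζ ^ cnt f 0 = ζ ^ cnt f 0 * (ζ * conj ζ) ^ cnt f 1 := by rw [hcc]; simp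
          _ = w f * ζ ^ cnt f 1 := by simp only [w]; rw [mul_pow]; ring
          _ = _ := by rw [h1, one_mul]
      have := hζ.pow_inj (by omega) (by omega) this
      omega
    have hwN : w f ^ N = 1 := by
      simp only [w]
      rw [mul_pow, ← pow_mul, ← pow_mul, mul_comm, mul_comm (cnt f 0), mul_comm (cnt f 1), pow_mul,
        pow_mul, ← map_pow, hζ.pow_eq_one]
      simp
    rw [geom_sum_eq hne, hwN]; simp
  have h1 : ∀ v, (N : ℂ) * η v = ∑ f, (c f * ∑ j ∈ Finset.range N, w f ^ j) * pf f v := by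
    intro v
    have h2 : ∀ j ∈ Finset.range N, η v = ∑ f, c f * (w f ^ j * pf f v) := by
      intro j _
      have h3 := ht (ζ ^ j) v
      have h4 : ζ ^ j * conj (ζ ^ j) = 1 := by rw [map_pow, ← mul_pow, hcc, one_pow]
      rw [h4, one_pow, one_mul] at h3
      rw [← h3, hc']
      refine Finset.sum_congr rfl fun f _ => ?_
      rw [pf_smul]
      simp only [w, map_pow]
      ring
    calc (N : ℂ) * η v = ∑ j ∈ Finset.range N, η v := by simp
      _ = _ := by
        rw [Finset.sum_congr rfl h2, Finset.sum_comm]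
        refine Finset.sum_congr rfl fun f _ => ?_
        rw [Finset.mul_sum, Finset.sum_mul]
        exact Finset.sum_congr rfl fun j _ => by ring
  have hN0 : (N : ℂ) ≠ 0 := Nat.cast_ne_zero.2 (by omega)
  have hF0 : ((2 * p).factorial : ℂ) ≠ 0 := by exact_mod_cast Nat.factorial_ne_zero _
  refine ⟨fun f => (c f * ∑ j ∈ Finset.range N, w f ^ j) / (N * (2 * p).factorial), ?_, ?_⟩
  · intro f hf
    simp [hw f hf]
  · intro v
    have h5 : ((2 * p).factorial : ℂ) * η v = ∑ σ : Equiv.Perm (Fin (2 * p)),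
        ((Equiv.Perm.sign σ : ℤ) : ℂ) * η (fun i => v (σ i)) := by
      have h6 : ∀ σ ∈ (Finset.univ : Finset (Equiv.Perm (Fin (2 * p)))),
          ((Equiv.Perm.sign σ : ℤ) : ℂ) * η (fun i => v (σ i)) = η v := by
        intro σ _
        have h7 : η (fun i => v (σ i)) = Equiv.Perm.sign σ • η v := (covMul h).map_perm v σ
        rw [h7]
        rcases Int.units_eq_one_or (Equiv.Perm.sign σ) with hs | hs <;> rw [hs] <;> simp
      rw [Finset.sum_congr rfl h6]
      simp [Fintype.card_perm]
    have h8 : (N : ℂ) * (((2 * p).factorial : ℂ) * η v) = ∑ f, (c f * ∑ j ∈ Finset.range N, w f ^ j)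
        * Matrix.det (Matrix.of fun i j => cj (f i).2 (v j (f i).1)) := by
      obtain ⟨d, hd⟩ : ∃ d : (Fin (2 * p) → Fin n × Fin 2) → ℂ,
        ∀ f, c f * ∑ j ∈ Finset.range N, w f ^ j = d f := ⟨_, fun _ => rfl⟩
      simp_rw [hd] at h1 ⊢
      rw [h5, Finset.mul_sum]
      simp_rw [mul_left_comm (N : ℂ), h1, Finset.mul_sum]
      rw [Finset.sum_comm]
      refine Finset.sum_congr rfl fun f _ => ?_
      rw [← Matrix.det_transpose, Matrix.det_apply', Finset.mul_sum]
      refine Finset.sum_congr rfl fun σ _ => ?_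
      simp only [pf, Matrix.transpose_apply, Matrix.of_apply]
      ring
    simp_rw [div_mul_eq_mul_div]
    rw [← Finset.sum_div, ← h8]
    field_simp

lemma det_balanced {n p : ℕ} (f : Fin (2 * p) → Fin n × Fin 2) (hf : cnt f 0 = p) :
    ∃ (g g' : Fin p → Fin n) (s : ℂ), ∀ v : Fin (2 * p) → Vec n,
      Matrix.det (Matrix.of fun i j => cj (f i).2 (v j (f i).1))
        = s * DD (fun k x => x (g k)) (fun k x => x (g' k)) v := by
  have hb : ∀ b, Fintype.card {i // (f i).2 = b} = p := by
    have := cnt_add f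
    have h1 : cnt f 1 = p := by omega
    intro b; fin_cases b
    · exact hf
    · exact h1
  let π : Fin p × Fin 2 ≃ Fin (2 * p) :=
    (Equiv.prodComm _ _).trans <| (Equiv.sigmaEquivProd (Fin 2) (Fin p)).symm.trans <|
      (Equiv.sigmaCongrRight fun b => (Fintype.equivFinOfCardEq (hb b)).symm).trans
        (Equiv.sigmaFiberEquiv fun i => (f i).2)
  have hπ : ∀ k b, (f (π (k, b))).2 = b := fun k b =>
    ((Fintype.equivFinOfCardEq (hb b)).symm k).2
  refine ⟨fun k => (f (π (k, 0))).1, fun k => (f (π (k, 1))).1,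
    ((Equiv.Perm.sign (π.trans (eqv p).symm) : ℤ) : ℂ), fun v => ?_⟩
  set M : Matrix (Fin (2 * p)) (Fin (2 * p)) ℂ :=
    Matrix.of fun i j => cj (f i).2 (v j (f i).1) with hM
  have h1 : DD (fun k x => x (f (π (k, 0))).1) (fun k x => x (f (π (k, 1))).1) v
      = ((M.submatrix (eqv p) (eqv p)).submatrix (π.trans (eqv p).symm) id).det := by
    unfold DD
    congr 1
    ext ⟨k, b⟩ j
    have := hπ k b
    fin_cases b
    · simp at this; simp [hM, cj, this]
    · simp at this; simp [hM, cj, this]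
  rw [h1, Matrix.det_permute, Matrix.det_submatrix_equiv_self, ← mul_assoc]
  rcases Int.units_eq_one_or (Equiv.Perm.sign (π.trans (eqv p).symm)) with hs | hs <;>
    rw [hs] <;> simp

lemma cov_DD {n p : ℕ} {η : (Fin (2 * p) → Vec n) → ℂ} (h : IsCov n (2 * p) η)
    (ht : IsTypePP n p η) : η ∈ Submodule.span ℂ (Set.range
      fun g : (Fin p → Fin n) × (Fin p → Fin n) =>
        (DD (fun k x => x (g.1 k)) (fun k x => x (g.2 k)) : (Fin (2 * p) → Vec n) → ℂ)) := by
  obtain ⟨c, hc, hη⟩ := cov_det h ht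
  have : η = ∑ f, c f • fun v : Fin (2 * p) → Vec n =>
      Matrix.det (Matrix.of fun i j => cj (f i).2 (v j (f i).1)) := by
    funext v; rw [hη]; simp [Finset.sum_apply]
  rw [this]
  refine Submodule.sum_mem _ fun f _ => ?_
  by_cases hf : cnt f 0 = p
  · obtain ⟨g, g', s, hs⟩ := det_balanced f hf
    refine Submodule.smul_mem _ _ ?_
    rw [show (fun v : Fin (2 * p) → Vec n =>
      Matrix.det (Matrix.of fun i j => cj (f i).2 (v j (f i).1)))
        = s • DD (fun k x => x (g k)) (fun k x => x (g' k)) from funext hs]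
    exact Submodule.smul_mem _ _ (Submodule.subset_span ⟨(g, g'), rfl⟩)
  · rw [hc f hf, zero_smul]; exact Submodule.zero_mem _


lemma IsCov_sub {n k : ℕ} {η θ : (Fin k → Vec n) → ℂ} (h : IsCov n k η) (h' : IsCov n k θ) :
    IsCov n k (fun v => η v - θ v) := by
  refine ⟨fun v i c x => ?_, fun v i x y => ?_, fun v i j hij hv => ?_⟩
  · simp only [h.1, h'.1]; ring
  · simp only [h.2.1, h'.2.1]; ring
  · simp only [h.2.2 v i j hij hv, h'.2.2 v i j hij hv]; ring

lemma IsCov_sum {n k N : ℕ} (a : Fin N → ℂ) {θ : Fin N → (Fin k → Vec n) → ℂ}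
    (h : ∀ s, IsCov n k (θ s)) : IsCov n k (fun v => ∑ s, a s * θ s v) := by
  refine ⟨fun v i c x => ?_, fun v i x y => ?_, fun v i j hij hv => ?_⟩
  · rw [Finset.mul_sum]
    exact Finset.sum_congr rfl fun s _ => by rw [(h s).1]; ring
  · rw [← Finset.sum_add_distrib]
    exact Finset.sum_congr rfl fun s _ => by rw [(h s).2.1]; ring
  · exact Finset.sum_eq_zero fun s _ => by rw [(h s).2.2 v i j hij hv]; ring

lemma IsCov_wedge (n p : ℕ) (ξ : Fin p → (Vec n →ₗ[ℂ] ℂ)) :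
    IsCov n (2 * p) (wedgeFam n p (fun k => omega1 n (ξ k))) := by
  have hT : ∀ v, wedgeFam n p (fun k => omega1 n (ξ k)) v = Complex.I ^ p * Matrix.det
      (Matrix.of fun (j i : Fin (2 * p)) => if ((eqv p).symm i).2 = 0 then
        ξ ((eqv p).symm i).1 (v j) else conj (ξ ((eqv p).symm i).1 (v j))) := by
    intro v
    rw [wedgeFam_eq, DD, ← Matrix.det_transpose, ← Matrix.det_submatrix_equiv_self (eqv p).symm]
    congr 2
    ext i j
    simp
  let R : Vec n → Fin (2 * p) → ℂ := fun x i => if ((eqv p).symm i).2 = 0 then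
        ξ ((eqv p).symm i).1 x else conj (ξ ((eqv p).symm i).1 x)
  have hT' : ∀ v, wedgeFam n p (fun k => omega1 n (ξ k)) v = Complex.I ^ p * Matrix.det
      (Matrix.of fun j => R (v j)) := hT
  have hu : ∀ (v : Fin (2 * p) → Vec n) i x, (Matrix.of fun j => R (Function.update v i x j))
      = (Matrix.of fun j => R (v j)).updateRow i (R x) := by
    intro v i x
    ext j l
    by_cases hj : j = i
    · subst hj; simp
    · simp [hj]
  refine ⟨fun v i c x => ?_, fun v i x y => ?_, fun v i j hij hv => ?_⟩
  · rw [hT', hT', hu, hu]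
    have : R (c • x) = (c : ℂ) • R x := by
      ext l
      have h0 : c • x = (c : ℂ) • x := by ext; simp
      simp only [R, h0, map_smul, Pi.smul_apply]
      split_ifs <;> simp
    rw [this, Matrix.det_updateRow_smul]; ring
  · rw [hT', hT', hT', hu, hu, hu]
    have : R (x + y) = R x + R y := by
      ext l
      simp only [R, map_add, Pi.add_apply]
      split_ifs <;> simp
    rw [this, Matrix.det_updateRow_add]; ring
  · rw [hT', Matrix.det_zero_of_row_eq hij, mul_zero]
    show R (v i) = R (v j)
    rw [hv]

lemma Type_wedge (n p : ℕ) (ξ : Fin p → (Vec n →ₗ[ℂ] ℂ)) :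
    IsTypePP n p (wedgeFam n p (fun k => omega1 n (ξ k))) := by
  intro c v
  rw [wedgeFam_eq, wedgeFam_eq, mul_left_comm]
  congr 1
  unfold DD
  have := Matrix.det_mul_column (fun i : Fin p × Fin 2 => if i.2 = 0 then c else conj c)
    (Matrix.of fun (i j : Fin p × Fin 2) =>
    if i.2 = 0 then ξ i.1 (v (eqv p j)) else conj (ξ i.1 (v (eqv p j))))
  rw [Fintype.prod_prod_type] at this
  simp [Fin.prod_univ_two] at this
  rw [← this]
  congr 1
  ext i j
  simp only [Matrix.of_apply, map_smul]
  split_ifs <;> simp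

lemma quad_zero {n : ℕ} (K : Matrix (Fin n) (Fin n) ℂ)
    (h : ∀ w : Fin n → ℂ, ∑ a, ∑ b, K a b * (w a * conj (w b)) = 0) : K = 0 := by
  have h1 : Matrix.toEuclideanLin K.transpose = 0 := by
    rw [← inner_map_self_eq_zero]
    intro x
    rw [← inner_conj_symm, map_eq_zero, ← h x.ofLp]
    rw [EuclideanSpace.inner_eq_star_dotProduct]
    simp [dotProduct, Matrix.toLpLin_apply, Matrix.mulVec, Finset.sum_mul]
    rw [Finset.sum_comm]
    exact Finset.sum_congr rfl fun a _ => Finset.sum_congr rfl fun b _ => by ring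
  have h2 : K.transpose = 0 := by simpa using h1
  simpa using h2

open scoped ComplexOrder in
lemma quad_pos {n : ℕ} (K : Matrix (Fin n) (Fin n) ℂ)
    (h : ∀ w : Fin n → ℂ, 0 ≤ (∑ a, ∑ b, K a b * (w a * conj (w b))).re ∧
      (∑ a, ∑ b, K a b * (w a * conj (w b))).im = 0) :
    ∃ B : Fin n → Fin n → ℂ, ∀ w : Fin n → ℂ, ∑ a, ∑ b, K a b * (w a * conj (w b))
      = ∑ s, (Complex.normSq (∑ a, B s a * w a) : ℂ) := by
  have h1 : K.transpose.PosSemidef := by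
    rw [← Matrix.isPositive_toEuclideanLin_iff, LinearMap.isPositive_iff_complex]
    intro x
    have e : inner ℂ (Matrix.toEuclideanLin K.transpose x) x
        = conj (∑ a, ∑ b, K a b * (x.ofLp a * conj (x.ofLp b))) := by
      rw [← inner_conj_symm]
      congr 1
      rw [EuclideanSpace.inner_eq_star_dotProduct]
      simp [dotProduct, Matrix.toLpLin_apply, Matrix.mulVec, Finset.sum_mul]
      rw [Finset.sum_comm]
      exact Finset.sum_congr rfl fun a _ => Finset.sum_congr rfl fun b _ => by ring
    obtain ⟨ha, hb⟩ := h x.ofLp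
    rw [e]
    generalize (∑ a, ∑ b, K a b * (x.ofLp a * conj (x.ofLp b))) = q at ha hb
    refine ⟨?_, by simpa using ha⟩
    apply Complex.ext
    · simp
    · rw [Complex.conj_im, hb]; simp
  obtain ⟨B, hB⟩ : ∃ B : Matrix (Fin n) (Fin n) ℂ, K.transpose = star B * B := by
    open scoped MatrixOrder Matrix.Norms.L2Operator in
    exact CStarAlgebra.nonneg_iff_eq_star_mul_self.mp h1.nonneg
  refine ⟨B, fun w => ?_⟩
  have hK : ∀ a b, K a b = ∑ s, conj (B s b) * B s a := by
    intro a b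
    have := congrFun (congrFun hB b) a
    rw [Matrix.transpose_apply, Matrix.mul_apply] at this
    rw [this]; rfl
  simp_rw [hK, ← Complex.mul_conj, map_sum, Finset.sum_mul_sum, Finset.sum_mul]
  symm
  rw [Finset.sum_comm]
  refine Finset.sum_congr rfl fun a _ => ?_
  rw [Finset.sum_comm]
  refine Finset.sum_congr rfl fun b _ => Finset.sum_congr rfl fun s _ => ?_
  rw [map_mul]; ring

lemma weak_strong {n p : ℕ} (F : Fin n → Fin p → Fin n)
    (H1 : ∀ g g' : Fin p → Fin n,
      (DD (fun k x => x (g k)) (fun k x => x (g' k)) : (Fin (2 * p) → Vec n) → ℂ) ∈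
      Submodule.span ℂ (Set.range fun ab : Fin n × Fin n =>
        (DD (fun k x => x (F ab.1 k)) (fun k x => x (F ab.2 k)) : (Fin (2 * p) → Vec n) → ℂ)))
    (H2 : ∀ w : Fin n → ℂ, w ≠ 0 → ∃ (x : Fin p → Vec n) (c : ℂ), c ≠ 0 ∧
      ∀ a, (Matrix.of fun k l => x l (F a k)).det = c * w a)
    (H3 : ∀ u : Fin n → ℂ, ∃ (ξ : Fin p → (Vec n →ₗ[ℂ] ℂ)) (c : ℂ), ∀ x : Fin p → Vec n,
      ∑ a, u a * (Matrix.of fun k l => x l (F a k)).det = c * (Matrix.of fun k l => ξ k (x l)).det)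
    (η : (Fin (2 * p) → Vec n) → ℂ) (hη : IsCov n (2 * p) η) (ht : IsTypePP n p η)
    (hw : WeaklyPos n p η) : StronglyPos n p η := by
  have H : ∀ θ : (Fin (2 * p) → Vec n) → ℂ, IsCov n (2 * p) θ → IsTypePP n p θ →
      ∃ K : Matrix (Fin n) (Fin n) ℂ,
        (∀ x, θ (pairUp n p x) = ∑ a, ∑ b, K a b * ((Matrix.of fun k l => x l (F a k)).det *
          conj (Matrix.of fun k l => x l (F b k)).det)) ∧ (K = 0 → ∀ v, θ v = 0) := by
    intro θ h1 h2
    have h3 := cov_DD h1 h2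
    have h4 := Submodule.span_le.2 (by rintro _ ⟨⟨g, g'⟩, rfl⟩; exact H1 g g') h3
    obtain ⟨c, hc⟩ := (Submodule.mem_span_range_iff_exists_fun ℂ).1 h4
    have hz : ((-2 * Complex.I) ^ p : ℂ) ≠ 0 := by simp
    refine ⟨Matrix.of fun a b => (-2 * Complex.I) ^ p * c (a, b), fun x => ?_, fun hK v => ?_⟩
    · rw [← hc, Finset.sum_apply, Fintype.sum_prod_type]
      refine Finset.sum_congr rfl fun a _ => Finset.sum_congr rfl fun b _ => ?_
      rw [Pi.smul_apply, DD_pairUp _ _ (by simp) (by simp), smul_eq_mul, Matrix.of_apply]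
      ring
    · rw [← hc, Finset.sum_apply]
      refine Finset.sum_eq_zero fun ab _ => ?_
      have := congrFun (congrFun hK ab.1) ab.2
      simp only [Matrix.of_apply, Matrix.zero_apply, mul_eq_zero, hz, false_or] at this
      simp [this]
  have Hq : ∀ (K : Matrix (Fin n) (Fin n) ℂ) (w : Fin n → ℂ), w ≠ 0 →
      ∃ (x : Fin p → Vec n) (r : ℝ), 0 < r ∧
        ∑ a, ∑ b, K a b * ((Matrix.of fun k l => x l (F a k)).det *
          conj (Matrix.of fun k l => x l (F b k)).det)
        = (r : ℂ) * ∑ a, ∑ b, K a b * (w a * conj (w b)) := by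
    intro K w hw0
    obtain ⟨x, c, hc, hx⟩ := H2 w hw0
    refine ⟨x, Complex.normSq c, Complex.normSq_pos.2 hc, ?_⟩
    rw [Finset.mul_sum]
    refine Finset.sum_congr rfl fun a _ => ?_
    rw [Finset.mul_sum]
    refine Finset.sum_congr rfl fun b _ => ?_
    rw [hx, hx, ← Complex.mul_conj, map_mul]; ring
  obtain ⟨K, hK, -⟩ := H η hη ht
  obtain ⟨B, hB⟩ := quad_pos K (by
    intro w
    by_cases hw0 : w = 0
    · simp [hw0]
    obtain ⟨x, r, hr, hx⟩ := Hq K w hw0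
    have := hw x
    rw [hK, hx, Complex.re_ofReal_mul, Complex.im_ofReal_mul] at this
    exact ⟨nonneg_of_mul_nonneg_right this.1 hr, (mul_eq_zero.1 this.2).resolve_left hr.ne'⟩)
  choose ξ c hξ using fun s => H3 (B s)
  refine ⟨n, fun s => Complex.normSq (c s) / 2 ^ p, ξ,
    fun s => div_nonneg (Complex.normSq_nonneg _) (by positivity), ?_⟩
  obtain ⟨K', hK', hz⟩ := H _ (IsCov_sub hη (IsCov_sum
    (fun s => ((Complex.normSq (c s) / 2 ^ p : ℝ) : ℂ)) fun s => IsCov_wedge n p (ξ s))) (by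
      intro z v
      simp only [ht z v, Type_wedge n p _ z v]
      rw [mul_sub, Finset.mul_sum]
      congr 1
      exact Finset.sum_congr rfl fun s _ => by ring)
  have hK0 : K' = 0 := by
    apply quad_zero
    intro w
    by_cases hw0 : w = 0
    · simp [hw0]
    obtain ⟨x, r, hr, hx⟩ := Hq K' w hw0
    rw [← hK'] at hx
    have h0 : (0 : ℂ) = r * ∑ a, ∑ b, K' a b * (w a * conj (w b)) := by
      rw [← hx, hK, hB, eq_comm, sub_eq_zero]
      refine Finset.sum_congr rfl fun s _ => ?_
      rw [wedgeFam_pairUp, hξ s x, map_mul]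
      push_cast
      field_simp
    exact (mul_eq_zero.1 h0.symm).resolve_left (by exact_mod_cast hr.ne')
  intro v
  exact sub_eq_zero.1 (hz hK0 v)


lemma exists_row {m : ℕ} (w : Fin (m + 1) → ℂ) (hw : w ≠ 0) :
    ∃ g : Matrix (Fin (m + 1)) (Fin (m + 1)) ℂ, IsUnit g.det ∧ ∀ a, g 0 a = w a := by
  obtain ⟨a, ha⟩ := Function.ne_iff.1 hw
  refine ⟨((1 : Matrix _ _ ℂ).updateRow a w).submatrix (Equiv.swap 0 a) id, ?_, ?_⟩
  · rw [Matrix.det_permute]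
    have : ((1 : Matrix _ _ ℂ).updateRow a w).det = w a := by
      have := Matrix.det_updateRow_sum (1 : Matrix (Fin (m + 1)) (Fin (m + 1)) ℂ) a w
      simp only [Matrix.det_one, smul_eq_mul, mul_one] at this
      rw [← this]
      congr 2
      ext j
      simp [Finset.sum_apply, Matrix.one_apply]
    rw [this, isUnit_iff_ne_zero]
    refine mul_ne_zero ?_ ha
    rcases Int.units_eq_one_or (Equiv.Perm.sign (Equiv.swap 0 a)) with hs | hs <;>
      rw [hs] <;> simp
  · intro b; simp

lemma H2_top {m : ℕ} (w : Fin (m + 1) → ℂ) (hw : w ≠ 0) :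
    ∃ (x : Fin m → Vec (m + 1)) (c : ℂ), c ≠ 0 ∧
      ∀ a : Fin (m + 1), (Matrix.of fun k l => x l (a.succAbove k)).det = c * w a := by
  obtain ⟨g, hg, hga⟩ := exists_row (fun a => (-1) ^ (a : ℕ) * w a) (by
    intro h; apply hw; ext a; simpa using congrFun h a)
  have hd : g⁻¹.det ≠ 0 := (Matrix.isUnit_nonsing_inv_det g hg).ne_zero
  refine ⟨fun l a => g⁻¹ a l.succ, g⁻¹.det, hd, fun a => ?_⟩
  have h1 := Matrix.adjugate_fin_succ_eq_det_submatrix g⁻¹ 0 a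
  have h2 : (g⁻¹).adjugate = g⁻¹.det • g := by
    have h3 := Matrix.mul_adjugate g⁻¹
    calc (g⁻¹).adjugate = g * (g⁻¹ * (g⁻¹).adjugate) := by
          rw [← mul_assoc, Matrix.mul_nonsing_inv g hg, one_mul]
      _ = _ := by rw [h3]; simp
  rw [h2, Matrix.smul_apply, hga] at h1
  have h4 : (Matrix.of fun k l => g⁻¹ (a.succAbove k) (Fin.succ l)).det
      = (g⁻¹.submatrix a.succAbove (Fin.succAbove 0)).det := by
    congr 1
  have h5 : ((-1 : ℂ) ^ (a : ℕ)) * (-1) ^ (a : ℕ) = 1 := by rw [← mul_pow]; simp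
  rw [h4]
  simp only [smul_eq_mul, Fin.val_zero, add_zero] at h1
  linear_combination (-(-1) ^ (a : ℕ)) * h1 +
    (g⁻¹.det * w a - (g⁻¹.submatrix a.succAbove (Fin.succAbove 0)).det) * h5

lemma H3_top {m : ℕ} (u : Fin (m + 1) → ℂ) :
    ∃ (ξ : Fin m → (Vec (m + 1) →ₗ[ℂ] ℂ)) (c : ℂ), ∀ x : Fin m → Vec (m + 1),
      ∑ a : Fin (m + 1), u a * (Matrix.of fun k l => x l (a.succAbove k)).det
        = c * (Matrix.of fun k l => ξ k (x l)).det := by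
  by_cases hu : u = 0
  · exact ⟨0, 0, fun x => by simp [hu]⟩
  obtain ⟨g, hg, hga⟩ := exists_row (fun a => (-1) ^ (a : ℕ) * u a) (by
    intro h; apply hu; ext a; simpa using congrFun h a)
  set h := g.transpose with hh
  have hd : IsUnit h.det := by rwa [hh, Matrix.det_transpose]
  have hcol : ∀ a, h a 0 = (-1) ^ (a : ℕ) * u a := hga
  refine ⟨fun k => (LinearMap.proj k.succ).comp (Matrix.mulVecLin h⁻¹), h.det, fun x => ?_⟩
  let E : Matrix (Fin (m + 1)) (Fin (m + 1)) ℂ :=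
    Matrix.of fun a j => Fin.cases (h a 0) (fun l => x l a) j
  have h1 : E.det = ∑ a : Fin (m + 1), u a * (Matrix.of fun k l => x l (a.succAbove k)).det := by
    rw [Matrix.det_succ_column_zero]
    refine Finset.sum_congr rfl fun a _ => ?_
    have h5 : ((-1 : ℂ) ^ (a : ℕ)) * (-1) ^ (a : ℕ) = 1 := by rw [← mul_pow]; simp
    have h6 : E.submatrix a.succAbove Fin.succ = Matrix.of fun k l => x l (a.succAbove k) := by
      ext k l; simp [E]
    have h7 : E a 0 = h a 0 := by simp [E]
    rw [h6, h7, hcol, ← mul_assoc, h5, one_mul]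
  have h2 : (h⁻¹ * E).det = (Matrix.of fun (k l : Fin m) =>
      ((LinearMap.proj k.succ).comp (Matrix.mulVecLin h⁻¹) : Vec (m + 1) →ₗ[ℂ] ℂ) (x l)).det := by
    have hc : ∀ i, (h⁻¹ * E) i 0 = (1 : Matrix (Fin (m + 1)) (Fin (m + 1)) ℂ) i 0 := by
      intro i
      rw [← Matrix.nonsing_inv_mul h hd, Matrix.mul_apply, Matrix.mul_apply]
      simp [E]
    rw [Matrix.det_succ_column_zero, Fin.sum_univ_succ]
    simp only [hc]
    rw [Finset.sum_eq_zero (fun i _ => by simp [Matrix.one_apply])]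
    simp only [Fin.val_zero, pow_zero, Matrix.one_apply_eq, one_mul, add_zero]
    congr 1
  rw [← h1, ← h2, ← Matrix.det_mul, ← mul_assoc, Matrix.mul_nonsing_inv h hd, one_mul]

lemma inj_succAbove {m : ℕ} (g : Fin m → Fin (m + 1)) (hg : Function.Injective g) :
    ∃ (a : Fin (m + 1)) (τ : Equiv.Perm (Fin m)), ∀ k, g k = a.succAbove (τ k) := by
  have : ¬ Function.Surjective g := by
    intro hs
    have := Fintype.card_le_of_surjective g hs
    simp at this
  obtain ⟨a, ha⟩ := not_forall.1 this
  have h1 : ∀ k, ∃ z, a.succAbove z = g k := fun k =>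
    Fin.exists_succAbove_eq fun h => ha ⟨k, h⟩
  choose τ hτ using h1
  have hi : Function.Injective τ := fun k l hkl => hg (by rw [← hτ, ← hτ, hkl])
  exact ⟨a, Equiv.ofBijective τ (Finite.injective_iff_bijective.1 hi), fun k => (hτ k).symm⟩

lemma H1_top {m : ℕ} (g g' : Fin m → Fin (m + 1)) :
    (DD (fun k x => x (g k)) (fun k x => x (g' k)) : (Fin (2 * m) → Vec (m + 1)) → ℂ) ∈
      Submodule.span ℂ (Set.range fun ab : Fin (m + 1) × Fin (m + 1) =>
        (DD (fun k x => x (ab.1.succAbove k)) (fun k x => x (ab.2.succAbove k)) :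
          (Fin (2 * m) → Vec (m + 1)) → ℂ)) := by
  by_cases hg : Function.Injective g
  swap
  · have : (DD (fun k x => x (g k)) (fun k x => x (g' k)) : (Fin (2 * m) → Vec (m + 1)) → ℂ) = 0 := by
      funext v
      simp only [Function.Injective, not_forall] at hg
      obtain ⟨k, l, hkl, hne⟩ := hg
      unfold DD
      refine Matrix.det_zero_of_row_eq (i := (k, 0)) (j := (l, 0)) (by simpa using hne) ?_
      funext j
      simp [hkl]
    rw [this]; exact Submodule.zero_mem _
  by_cases hg' : Function.Injective g'
  swap
  · have : (DD (fun k x => x (g k)) (fun k x => x (g' k)) : (Fin (2 * m) → Vec (m + 1)) → ℂ) = 0 := by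
      funext v
      simp only [Function.Injective, not_forall] at hg'
      obtain ⟨k, l, hkl, hne⟩ := hg'
      unfold DD
      refine Matrix.det_zero_of_row_eq (i := (k, 1)) (j := (l, 1)) (by simpa using hne) ?_
      funext j
      simp [hkl]
    rw [this]; exact Submodule.zero_mem _
  obtain ⟨a, τ, ha⟩ := inj_succAbove g hg
  obtain ⟨b, τ', hb⟩ := inj_succAbove g' hg'
  let P : Equiv.Perm (Fin m × Fin 2) := Equiv.prodCongrLeft ![τ, τ']
  have : (DD (fun k x => x (g k)) (fun k x => x (g' k)) : (Fin (2 * m) → Vec (m + 1)) → ℂ)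
      = ((Equiv.Perm.sign P : ℤ) : ℂ) •
        DD (fun k x => x (a.succAbove k)) (fun k x => x (b.succAbove k)) := by
    funext v
    rw [Pi.smul_apply, smul_eq_mul]
    unfold DD
    rw [← Matrix.det_permute]
    congr 1
    ext ⟨k, c⟩ j
    fin_cases c <;> simp [P, ha, hb]
  rw [this]
  exact Submodule.smul_mem _ _ (Submodule.subset_span ⟨(a, b), rfl⟩)

lemma case_one (n : ℕ) (η : (Fin (2 * 1) → Vec n) → ℂ) (hη : IsCov n (2 * 1) η)
    (ht : IsTypePP n 1 η) (hw : WeaklyPos n 1 η) : StronglyPos n 1 η := by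
  refine weak_strong (fun a _ => a) ?_ ?_ ?_ η hη ht hw
  · intro g g'
    refine Submodule.subset_span ⟨(g 0, g' 0), ?_⟩
    have e1 : g = fun _ => g 0 := by funext k; rw [Subsingleton.elim k 0]
    have e2 : g' = fun _ => g' 0 := by funext k; rw [Subsingleton.elim k 0]
    rw [e1, e2]
  · intro w _
    exact ⟨fun _ => w, 1, one_ne_zero, fun a => by simp⟩
  · intro u
    refine ⟨fun _ => ∑ a, u a • LinearMap.proj a, 1, fun x => ?_⟩
    simp [LinearMap.sum_apply]

lemma case_top (m : ℕ) (η : (Fin (2 * m) → Vec (m + 1)) → ℂ) (hη : IsCov (m + 1) (2 * m) η)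
    (ht : IsTypePP (m + 1) m η) (hw : WeaklyPos (m + 1) m η) : StronglyPos (m + 1) m η :=
  weak_strong (fun a => a.succAbove) H1_top H2_top H3_top η hη ht hw

end


/-- **Weak = strong positivity in bidegrees `(1,1)` and `(n-1,n-1)`.**  A real
`(p,p)`-covector on an `n`-dimensional complex vector space is weakly positive iff it
is strongly positive, for `p = 1` and for `p = n - 1`. -/
theorem weak_eq_strong_extreme_bidegrees (n : ℕ) (hn : 1 ≤ n) :
    (∀ η : (Fin (2 * 1) → Vec n) → ℂ,
      IsCov n (2 * 1) η → IsTypePP n 1 η → IsRealPP n 1 η →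
      (WeaklyPos n 1 η ↔ StronglyPos n 1 η)) ∧
    (∀ η : (Fin (2 * (n - 1)) → Vec n) → ℂ,
      IsCov n (2 * (n - 1)) η → IsTypePP n (n - 1) η → IsRealPP n (n - 1) η →
      (WeaklyPos n (n - 1) η ↔ StronglyPos n (n - 1) η)) := by

  obtain ⟨m, rfl⟩ : ∃ m, n = m + 1 := ⟨n - 1, by omega⟩
  exact ⟨fun η h1 h2 _ => ⟨case_one _ η h1 h2, strong_weak _ _ η⟩,
    fun η h1 h2 _ => ⟨case_top m η h1 h2, strong_weak _ _ η⟩⟩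
end

section
/- Let (V, Ω) be a complex symplectic vector space of dimension 2n, and W ⊆ V a subspace of codimension p ≤ n. Then (Ω^{n-p+1} ∧ Ω̄^{n-p+1})|_W = 0 if and only if Ω^{n-p+1}|_W = 0, if and only if W is coisotropic (the rank of Ω|_W equals 2(n−p)). -/
open ComplexConjugate

namespace CoisoAux

/-- The standard symplectic matrix on `κ × Fin 2`. -/
def J {κ : Type} [DecidableEq κ] (a b : κ × Fin 2) : ℂ :=
  if a.1 = b.1 then (if a.2 = b.2 then 0 else if a.2 = 0 then 1 else -1) else 0

/-- The alternating sum of products. -/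
noncomputable def PS {κ E : Type} [Fintype κ] [DecidableEq κ] (F : κ → E → E → ℂ)
    (x : κ × Fin 2 → E) : ℂ :=
  ∑ σ : Equiv.Perm (κ × Fin 2), ((Equiv.Perm.sign σ : ℤ) : ℂ) *
    ∏ k : κ, F k (x (σ (k, 0))) (x (σ (k, 1)))

lemma key_term {κ : Type} [Fintype κ] [DecidableEq κ] (σ : Equiv.Perm (κ × Fin 2))
    (h : ∀ k, J (σ (k, 0)) (σ (k, 1)) ≠ 0) :
    ((Equiv.Perm.sign σ : ℤ) : ℂ) * ∏ k : κ, J (σ (k, 0)) (σ (k, 1)) = 1 := by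
  have h1 : ∀ k, (σ (k, 0)).1 = (σ (k, 1)).1 := by
    intro k; by_contra hc; exact h k (by simp [J, hc])
  have h2 : ∀ k, (σ (k, 0)).2 ≠ (σ (k, 1)).2 := by
    intro k hc; exact h k (by simp [J, hc])
  let ε : κ → Equiv.Perm (Fin 2) := fun k =>
    if (σ (k, 0)).2 = 0 then 1 else Equiv.swap 0 1
  have hinj : Function.Injective (fun k => (σ (k, 0)).1) := by
    intro k l hkl
    simp only at hkl
    have : (σ (l, 0)).2 = (σ (k, 0)).2 ∨ (σ (l, 0)).2 = (σ (k, 1)).2 := by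
      have := h2 k
      omega
    rcases this with h3 | h3
    · have : σ (l, 0) = σ (k, 0) := Prod.ext hkl.symm h3
      simpa using (σ.injective this).symm
    · have : σ (l, 0) = σ (k, 1) := Prod.ext (hkl.symm.trans (h1 k)) h3
      simpa using (σ.injective this).symm
  let τ : Equiv.Perm κ := Equiv.ofBijective _ (Finite.injective_iff_bijective.mp hinj)
  have hτ : ∀ k, τ k = (σ (k, 0)).1 := fun k => rfl
  have hσ : σ = Equiv.prodCongrLeft (fun _ : Fin 2 => τ) * Equiv.prodCongrRight ε := by
    apply Equiv.ext
    rintro ⟨k, t⟩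
    have h2k := h2 k
    rw [Equiv.Perm.mul_apply, Equiv.prodCongrRight_apply, Equiv.prodCongrLeft_apply, hτ]
    have hc : ∀ t : Fin 2, t = 0 ∨ t = 1 := by decide
    rcases hc t with rfl | rfl
    · refine Prod.ext rfl ?_
      by_cases h0 : (σ (k, 0)).2 = 0
      · simp [ε, h0]
      · simp [ε, h0]; omega
    · refine Prod.ext (h1 k).symm ?_
      by_cases h0 : (σ (k, 0)).2 = 0
      · simp [ε, h0]; omega
      · simp [ε, h0]; omega
  have hs : Equiv.Perm.sign σ = ∏ k, Equiv.Perm.sign (ε k) := by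
    conv_lhs => rw [hσ]
    rw [Equiv.Perm.sign_mul, Equiv.Perm.sign_prodCongrLeft, Equiv.Perm.sign_prodCongrRight]
    simp
  have hJ : ∀ k, J (σ (k, 0)) (σ (k, 1)) = ((Equiv.Perm.sign (ε k) : ℤ) : ℂ) := by
    intro k
    by_cases h0 : (σ (k, 0)).2 = 0
    · have := h2 k
      rw [h0] at this
      simp [J, h1, ε, h0, this]
    · have := h2 k
      simp [J, h1, ε, h0, this]
  simp only [hJ, hs]
  push_cast
  rw [← Finset.prod_mul_distrib]
  apply Finset.prod_eq_one
  intro k _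
  rcases Int.units_eq_one_or (Equiv.Perm.sign (ε k)) with h | h <;> simp [h]

lemma key_sum {κ : Type} [Fintype κ] [DecidableEq κ]
    (G : κ → κ × Fin 2 → κ × Fin 2 → ℂ)
    (hG : ∀ k a b, G k a b = 0 ∨ G k a b = J a b)
    (hG1 : ∀ k, G k (k, 0) (k, 1) ≠ 0) : PS G id ≠ 0 := by
  classical
  have : ∀ σ : Equiv.Perm (κ × Fin 2), ((Equiv.Perm.sign σ : ℤ) : ℂ) *
      ∏ k : κ, G k (id (σ (k, 0))) (id (σ (k, 1))) =
      if ∀ k, G k (σ (k, 0)) (σ (k, 1)) ≠ 0 then 1 else 0 := by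
    intro σ
    split_ifs with h
    · have h' : ∀ k, G k (σ (k, 0)) (σ (k, 1)) = J (σ (k, 0)) (σ (k, 1)) :=
        fun k => (hG k _ _).resolve_left (h k)
      simp only [id, h']
      exact key_term σ (fun k => h' k ▸ h k)
    · push Not at h
      obtain ⟨k, hk⟩ := h
      rw [Finset.prod_eq_zero (Finset.mem_univ k) hk, mul_zero]
  rw [PS, Finset.sum_congr rfl (fun σ _ => this σ), Finset.sum_boole]
  have : (1 : Equiv.Perm (κ × Fin 2)) ∈ Finset.univ.filter
      (fun σ : Equiv.Perm (κ × Fin 2) => ∀ k, G k (σ (k, 0)) (σ (k, 1)) ≠ 0) := by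
    simpa using hG1
  exact_mod_cast (Finset.card_pos.mpr ⟨_, this⟩).ne'

/-- The index equivalence. -/
def ix (q : ℕ) : Fin q × Fin 2 ≃ Fin (2 * q) :=
  finProdFinEquiv.trans (finCongr (mul_comm q 2))

lemma wedgeFam_eq (N q : ℕ) {κ : Type} [Fintype κ] [DecidableEq κ] (ε : κ ≃ Fin q)
    (ω : Fin q → ((Fin 2 → Vec N) → ℂ)) (v : Fin (2 * q) → Vec N) :
    wedgeFam N q ω v = (1 / (2 ^ q : ℂ)) *
      PS (fun k x y => ω (ε k) ![x, y])
        (v ∘ ((Equiv.prodCongr ε (Equiv.refl (Fin 2))).trans (ix q))) := by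
  rw [wedgeFam, PS]
  congr 1
  set e := (Equiv.prodCongr ε (Equiv.refl (Fin 2))).trans (ix q) with he
  refine (Fintype.sum_equiv e.permCongr _ _ ?_).symm
  intro σ
  rw [Equiv.Perm.sign_permCongr]
  congr 1
  refine Fintype.prod_equiv ε _ _ ?_
  intro k
  have e0 : e.symm ⟨2 * (ε k).1, by have := (ε k).2; omega⟩ = (k, 0) := by
    rw [Equiv.symm_apply_eq]
    apply Fin.ext
    simp [he, ix]
  have e1 : e.symm ⟨2 * (ε k).1 + 1, by have := (ε k).2; omega⟩ = (k, 1) := by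
    rw [Equiv.symm_apply_eq]
    apply Fin.ext
    simp [he, ix]
    omega
  simp only [Equiv.permCongr_apply, e0, e1, Function.comp]

/-- Vanishing of a wedge power on `W` in terms of `PS`. -/
lemma wedgeFam_zero_iff (N q : ℕ) {κ : Type} [Fintype κ] [DecidableEq κ] (ε : κ ≃ Fin q)
    (ω : Fin q → ((Fin 2 → Vec N) → ℂ)) (W : Set (Vec N)) :
    (∀ v : Fin (2 * q) → Vec N, (∀ j, v j ∈ W) → wedgeFam N q ω v = 0) ↔
    ∀ x : κ × Fin 2 → Vec N, (∀ j, x j ∈ W) → PS (fun k x y => ω (ε k) ![x, y]) x = 0 := by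
  set e := (Equiv.prodCongr ε (Equiv.refl (Fin 2))).trans (ix q) with he
  constructor
  · intro h x hx
    have := h (x ∘ e.symm) (fun j => hx _)
    rw [wedgeFam_eq N q ε, ← he] at this
    have h2 : (x ∘ e.symm) ∘ e = x := by ext1 j; simp
    rw [h2] at this
    simpa using this
  · intro h v hv
    rw [wedgeFam_eq N q ε, h (v ∘ _) (fun j => hv _), mul_zero]

/-- Embedding of permutations of the first half. -/
def hat {κ : Type} (τ : Equiv.Perm (κ × Fin 2)) : Equiv.Perm ((κ ⊕ κ) × Fin 2) :=
  (Equiv.sumProdDistrib κ κ (Fin 2)).symm.permCongr (Equiv.sumCongr τ 1)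

lemma hat_inl {κ : Type} (τ : Equiv.Perm (κ × Fin 2)) (k : κ) (t : Fin 2) :
    hat τ (Sum.inl k, t) = (Sum.inl (τ (k, t)).1, (τ (k, t)).2) := by
  simp [hat, Equiv.permCongr_apply]

lemma hat_inr {κ : Type} (τ : Equiv.Perm (κ × Fin 2)) (k : κ) (t : Fin 2) :
    hat τ (Sum.inr k, t) = (Sum.inr k, t) := by
  simp [hat, Equiv.permCongr_apply]

lemma sign_hat {κ : Type} [Fintype κ] [DecidableEq κ] (τ : Equiv.Perm (κ × Fin 2)) :
    Equiv.Perm.sign (hat τ) = Equiv.Perm.sign τ := by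
  rw [hat, Equiv.Perm.sign_permCongr, Equiv.Perm.sign_sumCongr]; simp

lemma half_zero {κ E : Type} [Fintype κ] [DecidableEq κ] (B : E → E → ℂ) (F : κ → E → E → ℂ)
    (W : Set E) (h : ∀ y : κ × Fin 2 → E, (∀ j, y j ∈ W) → PS (fun _ => B) y = 0)
    (x : (κ ⊕ κ) × Fin 2 → E) (hx : ∀ j, x j ∈ W) :
    PS (Sum.elim (fun _ => B) F) x = 0 := by
  set g : Equiv.Perm ((κ ⊕ κ) × Fin 2) → ℂ := fun σ => ((Equiv.Perm.sign σ : ℤ) : ℂ) *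
    ∏ k : κ ⊕ κ, (Sum.elim (fun _ => B) F : κ ⊕ κ → E → E → ℂ) k (x (σ (k, 0))) (x (σ (k, 1)))
    with hg
  have h1 : ∀ τ : Equiv.Perm (κ × Fin 2), ∑ σ, g (σ * hat τ) = ∑ σ, g σ := fun τ =>
    Fintype.sum_equiv (Equiv.mulRight (hat τ)) _ _ (fun σ => rfl)
  have h2 : ∀ σ, ∑ τ : Equiv.Perm (κ × Fin 2), g (σ * hat τ) = 0 := by
    intro σ
    have := h (fun j => x (σ (Sum.inl j.1, j.2))) (fun j => hx _)
    rw [PS] at this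
    have h3 : ∀ τ : Equiv.Perm (κ × Fin 2), g (σ * hat τ) =
        (((Equiv.Perm.sign σ : ℤ) : ℂ) *
          ∏ k : κ, F k (x (σ (Sum.inr k, 0))) (x (σ (Sum.inr k, 1)))) *
        (((Equiv.Perm.sign τ : ℤ) : ℂ) * ∏ k : κ, B (x (σ (Sum.inl (τ (k, 0)).1, (τ (k, 0)).2)))
          (x (σ (Sum.inl (τ (k, 1)).1, (τ (k, 1)).2)))) := by
      intro τ
      simp only [hg, Fintype.prod_sum_type, Sum.elim_inl, Sum.elim_inr, Equiv.Perm.mul_apply,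
        hat_inl, hat_inr, Equiv.Perm.sign_mul, sign_hat]
      push_cast
      ring
    simp only [h3]
    rw [← Finset.mul_sum, this, mul_zero]
  have h4 : ∑ τ : Equiv.Perm (κ × Fin 2), ∑ σ, g σ = 0 := by
    rw [← Finset.sum_congr rfl (fun τ _ => h1 τ), Finset.sum_comm]
    exact Finset.sum_eq_zero (fun σ _ => h2 σ)
  rw [Finset.sum_const, nsmul_eq_mul] at h4
  rcases mul_eq_zero.mp h4 with h5 | h5
  · exact absurd h5 (by simp [Fintype.card_ne_zero])
  · exact h5

/-- Multilinear product. -/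
noncomputable def prodML {κ E : Type} [Fintype κ] [AddCommGroup E] [Module ℂ E]
    (B : E →ₗ[ℂ] E →ₗ[ℂ] ℂ) : MultilinearMap ℂ (fun _ : κ × Fin 2 => E) ℂ where
  toFun x := ∏ k : κ, B (x (k, 0)) (x (k, 1))
  map_update_add' := by
    classical
    intro d x i a b
    obtain ⟨k, t⟩ := i
    have key : ∀ z : E, ∏ l ∈ ({k}ᶜ : Finset κ), B (Function.update x (k, t) z (l, 0))
        (Function.update x (k, t) z (l, 1)) = ∏ l ∈ ({k}ᶜ : Finset κ), B (x (l, 0)) (x (l, 1)) := by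
      intro z
      refine Finset.prod_congr rfl (fun l hl => ?_)
      have : l ≠ k := by simpa using hl
      rw [Function.update_of_ne (by simp [this]), Function.update_of_ne (by simp [this])]
    simp only [Fintype.prod_eq_mul_prod_compl k, key]
    rw [← add_mul]
    congr 1
    have hc : ∀ t : Fin 2, t = 0 ∨ t = 1 := by decide
    rcases hc t with rfl | rfl <;> simp [Function.update_apply]
  map_update_smul' := by
    classical
    intro d x i c a
    obtain ⟨k, t⟩ := i
    have key : ∀ z : E, ∏ l ∈ ({k}ᶜ : Finset κ), B (Function.update x (k, t) z (l, 0))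
        (Function.update x (k, t) z (l, 1)) = ∏ l ∈ ({k}ᶜ : Finset κ), B (x (l, 0)) (x (l, 1)) := by
      intro z
      refine Finset.prod_congr rfl (fun l hl => ?_)
      have : l ≠ k := by simpa using hl
      rw [Function.update_of_ne (by simp [this]), Function.update_of_ne (by simp [this])]
    simp only [Fintype.prod_eq_mul_prod_compl k, key]
    rw [smul_eq_mul, ← mul_assoc]
    congr 1
    have hc : ∀ t : Fin 2, t = 0 ∨ t = 1 := by decide
    rcases hc t with rfl | rfl <;> simp [Function.update_apply]

lemma PS_alt {κ E : Type} [Fintype κ] [DecidableEq κ] [AddCommGroup E] [Module ℂ E]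
    (B : E →ₗ[ℂ] E →ₗ[ℂ] ℂ) (x : κ × Fin 2 → E) :
    PS (fun _ : κ => fun a b => B a b) x = MultilinearMap.alternatization (prodML B) x := by
  rw [PS, MultilinearMap.alternatization_apply]
  refine Finset.sum_congr rfl (fun σ _ => ?_)
  rw [Units.smul_def, zsmul_eq_mul]
  rfl

lemma PS_zero_of_rank {m : ℕ} {E : Type} [AddCommGroup E] [Module ℂ E]
    [FiniteDimensional ℂ E]
    (B : E →ₗ[ℂ] E →ₗ[ℂ] ℂ) (hB : ∀ x, B x x = 0) (W K : Submodule ℂ E)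
    (hK : ∀ v, v ∈ K ↔ v ∈ W ∧ ∀ w ∈ W, B v w = 0)
    (hr : Module.finrank ℂ W < Module.finrank ℂ K + 2 * m)
    (x : Fin m × Fin 2 → E) (hx : ∀ j, x j ∈ W) :
    PS (fun _ : Fin m => fun a b => B a b) x = 0 := by
  have hsk : ∀ a b, B a b = - B b a := by
    intro a b
    have := hB (a + b)
    simp [hB] at this
    linear_combination this
  have hdep : ¬ LinearIndependent ℂ (K.mkQ ∘ x) := by
    intro hli
    have h1 := finrank_span_eq_card hli
    have h2 : Submodule.span ℂ (Set.range (K.mkQ ∘ x)) ≤ LinearMap.range (K.mkQ.domRestrict W) := by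
      rw [Submodule.span_le]
      rintro _ ⟨j, rfl⟩
      exact ⟨⟨x j, hx j⟩, rfl⟩
    have h3 := Submodule.finrank_mono h2
    have h4 := LinearMap.finrank_range_add_finrank_ker (K.mkQ.domRestrict W)
    have h5 : Module.finrank ℂ (LinearMap.ker (K.mkQ.domRestrict W)) = Module.finrank ℂ K := by
      have : LinearMap.ker (K.mkQ.domRestrict W) = K.comap W.subtype := by
        ext w; simp
      rw [this]
      exact (Submodule.comapSubtypeEquivOfLe (fun v hv => ((hK v).mp hv).1)).finrank_eq
    rw [h1] at h3
    simp at h3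
    omega
  rw [Fintype.not_linearIndependent_iff] at hdep
  obtain ⟨c, hc, j, hj⟩ := hdep
  have hmem : ∑ i, c i • x i ∈ K := by
    rw [← Submodule.ker_mkQ K, LinearMap.mem_ker, map_sum]
    simpa using hc
  rw [PS_alt]
  set g := MultilinearMap.alternatization (prodML (κ := Fin m) B) with hgdef
  have h1 : g (Function.update x j (∑ i, c i • x i)) = c j * g x := by
    rw [AlternatingMap.map_update_sum, Finset.sum_eq_single j]
    · rw [AlternatingMap.map_update_smul, Function.update_eq_self]; rfl
    · intro b _ hb
      rw [AlternatingMap.map_update_smul, AlternatingMap.map_update_self _ _ hb.symm, smul_zero]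
    · simp
  have h2 : g (Function.update x j (∑ i, c i • x i)) = 0 := by
    set z := ∑ i, c i • x i with hz
    have hzK := (hK z).mp hmem
    have hW : ∀ i, Function.update x j z i ∈ W := by
      intro i
      by_cases h : i = j
      · subst h; simpa using hzK.1
      · simpa [h] using hx i
    rw [hgdef, ← PS_alt, PS]
    refine Finset.sum_eq_zero (fun σ _ => ?_)
    have hc : ∀ t : Fin 2, t = 0 ∨ t = 1 := by decide
    obtain ⟨⟨k, t⟩, hk⟩ := σ.surjective j
    rw [Finset.prod_eq_zero (Finset.mem_univ k), mul_zero]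
    rcases hc t with rfl | rfl
    · rw [hk, Function.update_self]; exact hzK.2 _ (hW _)
    · rw [hk, Function.update_self, hsk, hzK.2 _ (hW _), neg_zero]
  rw [h1] at h2
  exact (mul_eq_zero.mp h2).resolve_left hj

lemma exists_sympl {E : Type} [AddCommGroup E] [Module ℂ E]
    [FiniteDimensional ℂ E]
    (B : E →ₗ[ℂ] E →ₗ[ℂ] ℂ) (hB : ∀ x, B x x = 0) (m : ℕ) : ∀ (W K : Submodule ℂ E)
    (_ : ∀ v, v ∈ K ↔ v ∈ W ∧ ∀ w ∈ W, B v w = 0)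
    (_ : Module.finrank ℂ K + 2 * m ≤ Module.finrank ℂ W + 1),
    ∃ u : Fin m × Fin 2 → E, (∀ j, u j ∈ W) ∧ ∀ a b, B (u a) (u b) = J a b := by
  have hsk : ∀ a b, B a b = - B b a := by
    intro a b
    have := hB (a + b)
    simp [hB] at this
    linear_combination this
  induction m with
  | zero => intro W K _ _; exact ⟨fun j => j.1.elim0, fun j => j.1.elim0, fun a => a.1.elim0⟩
  | succ m ih =>
    intro W K hK hr
    have hKW : K ≤ W := fun v hv => ((hK v).mp hv).1
    have hlt : ¬ W ≤ K := by
      intro h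
      have := Submodule.finrank_mono h
      omega
    obtain ⟨e, heW, heK⟩ := SetLike.not_le_iff_exists.mp hlt
    have : ∃ f ∈ W, B e f ≠ 0 := by
      by_contra! hc
      exact heK ((hK e).mpr ⟨heW, hc⟩)
    obtain ⟨f', hf', hne⟩ := this
    obtain ⟨f, hfW, hef⟩ : ∃ f ∈ W, B e f = 1 :=
      ⟨(B e f')⁻¹ • f', W.smul_mem _ hf', by simp [hne]⟩
    have hfe : B f e = -1 := by rw [hsk, hef]
    let W' : Submodule ℂ E := W ⊓ (LinearMap.ker (B e) ⊓ LinearMap.ker (B f))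
    have hW' : ∀ v, v ∈ W' ↔ v ∈ W ∧ B e v = 0 ∧ B f v = 0 := by
      intro v; simp [W']
    let K' : Submodule ℂ E :=
      { carrier := {v | v ∈ W' ∧ ∀ w ∈ W', B v w = 0}
        add_mem' := by
          rintro a b ⟨ha, ha'⟩ ⟨hb, hb'⟩
          exact ⟨W'.add_mem ha hb, fun w hw => by simp [ha' w hw, hb' w hw]⟩
        zero_mem' := ⟨W'.zero_mem, by simp⟩
        smul_mem' := by
          rintro c a ⟨ha, ha'⟩
          exact ⟨W'.smul_mem c ha, fun w hw => by simp [ha' w hw]⟩ }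
    have hK' : ∀ v, v ∈ K' ↔ v ∈ W' ∧ ∀ w ∈ W', B v w = 0 := fun v => Iff.rfl
    have hdec : ∀ w ∈ W, w - (B w f) • e + (B w e) • f ∈ W' := by
      intro w hw
      rw [hW']
      refine ⟨W.add_mem (W.sub_mem hw (W.smul_mem _ heW)) (W.smul_mem _ hfW), ?_, ?_⟩
      · simp [hB, hef, hsk w e]
      · simp [hB, hfe, hsk w f]
    have hKK : K' ≤ K := by
      intro v hv
      obtain ⟨hv1, hv2⟩ := (hK' v).mp hv
      obtain ⟨hv3, hv4, hv5⟩ := (hW' v).mp hv1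
      rw [hK]
      refine ⟨hv3, fun w hw => ?_⟩
      have := hv2 _ (hdec w hw)
      simpa [hsk v e, hsk v f, hv4, hv5] using this
    have hWle : W ≤ W' ⊔ Submodule.span ℂ {e, f} := by
      intro w hw
      have : w = (w - (B w f) • e + (B w e) • f) + ((B w f) • e + (-(B w e)) • f) := by
        rw [neg_smul]; abel
      rw [this]
      refine Submodule.add_mem_sup (hdec w hw) ?_
      exact Submodule.mem_span_pair.mpr ⟨_, _, rfl⟩
    have hd1 := Submodule.finrank_mono hWle
    have hd2 := Submodule.finrank_add_le_finrank_add_finrank W' (Submodule.span ℂ {e, f})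
    have hd3 : Module.finrank ℂ (Submodule.span ℂ ({e, f} : Set E)) ≤ 2 := by
      classical
      have := finrank_span_finset_le_card (R := ℂ) ({e, f} : Finset E)
      simp only [Finset.coe_insert, Finset.coe_singleton] at this
      exact this.trans Finset.card_le_two
    have hd4 := Submodule.finrank_mono hKK
    obtain ⟨u, hu1, hu2⟩ := ih W' K' hK' (by omega)
    refine ⟨fun j => Fin.cases (if j.2 = 0 then e else f) (fun k => u (k, j.2)) j.1, ?_, ?_⟩
    · rintro ⟨k, t⟩
      refine Fin.cases ?_ (fun k => ?_) k
      · simp only [Fin.cases_zero]; split_ifs <;> assumption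
      · exact ((hW' _).mp (hu1 _)).1
    · have hc : ∀ t : Fin 2, t = 0 ∨ t = 1 := by decide
      rintro ⟨k, t⟩ ⟨l, s⟩
      refine Fin.cases ?_ (fun k => ?_) k <;> refine Fin.cases ?_ (fun l => ?_) l
      · rcases hc t with rfl | rfl <;> rcases hc s with rfl | rfl <;>
          simp [J, hB, hef, hfe]
      · have := (hW' _).mp (hu1 (l, s))
        rcases hc t with rfl | rfl <;> simp [J, this, (Fin.succ_ne_zero l).symm]
      · have := (hW' _).mp (hu1 (k, t))
        rw [hsk]
        rcases hc s with rfl | rfl <;> simp [J, this, (Fin.succ_ne_zero k)]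
      · simp [hu2, J]

/-- Characters of the two kinds of factors on `{1, I}`. -/
noncomputable def chi {κ : Type} : κ ⊕ κ → Fin 2 → ℂ :=
  Sum.elim (fun _ => ![1, Complex.I]) (fun _ => ![1, -Complex.I])

lemma double_nonzero {m : ℕ} {E : Type} [AddCommGroup E] [Module ℂ E]
    (B : E →ₗ[ℂ] E →ₗ[ℂ] ℂ) (W : Submodule ℂ E)
    (u : Fin m × Fin 2 → E) (hu : ∀ j, u j ∈ W) (hJ : ∀ a b, B (u a) (u b) = J a b)
    (h : ∀ x : (Fin m ⊕ Fin m) × Fin 2 → E, (∀ j, x j ∈ W) →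
      PS (Sum.elim (fun _ => fun a b => B a b) (fun _ => fun a b => conj (B a b))) x = 0) :
    False := by
  let F : Fin m ⊕ Fin m → E → E → ℂ :=
    Sum.elim (fun _ => fun a b => B a b) (fun _ => fun a b => conj (B a b))
  let x0 : (Fin m ⊕ Fin m) × Fin 2 → E := fun a => u (Sum.elim id id a.1, a.2)
  let cc : Fin 2 → ℂ := ![1, Complex.I]
  let w : Fin m ⊕ Fin m → Fin 2 → ℂ :=
    Sum.elim (fun _ => ![1, -Complex.I]) (fun _ => ![1, Complex.I])
  let S : Fin m ⊕ Fin m → Fin m ⊕ Fin m → ℂ := fun k a => ∑ b, w a b * chi k b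
  let G : Fin m ⊕ Fin m → (Fin m ⊕ Fin m) × Fin 2 → (Fin m ⊕ Fin m) × Fin 2 → ℂ :=
    fun k a b => S k a.1 * S k b.1 * F k (x0 a) (x0 b)
  have hF : ∀ k s t a b, F k (cc s • a) (cc t • b) = chi k s * chi k t * F k a b := by
    have hc : ∀ t : Fin 2, t = 0 ∨ t = 1 := by decide
    rintro (k | k) s t a b <;> rcases hc s with rfl | rfl <;> rcases hc t with rfl | rfl <;>
      simp [F, cc, chi, ← mul_assoc]
  have hGz : PS G id = 0 := by
    have h1 : PS G id = ∑ s : (Fin m ⊕ Fin m) × Fin 2 → Fin 2,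
        (∏ j, w j.1 (s j)) * PS F (fun j => cc (s j) • x0 j) := by
      simp only [PS, hF, Finset.mul_sum]
      rw [Finset.sum_comm]
      refine Finset.sum_congr rfl (fun σ _ => ?_)
      have h2 : ∀ s : (Fin m ⊕ Fin m) × Fin 2 → Fin 2,
          (∏ j, w j.1 (s j)) * (((Equiv.Perm.sign σ : ℤ) : ℂ) *
            ∏ k, chi k (s (σ (k, 0))) * chi k (s (σ (k, 1))) *
              F k (x0 (σ (k, 0))) (x0 (σ (k, 1)))) =
          (((Equiv.Perm.sign σ : ℤ) : ℂ) * ∏ k, F k (x0 (σ (k, 0))) (x0 (σ (k, 1)))) *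
          ∏ j, (w j.1 (s j) * chi (σ.symm j).1 (s j)) := by
        intro s
        have h3 : ∏ j, chi (σ.symm j).1 (s j) =
            ∏ k, chi k (s (σ (k, 0))) * chi k (s (σ (k, 1))) := by
          rw [← Equiv.prod_comp σ, Fintype.prod_prod_type]
          simp
        rw [Finset.prod_mul_distrib (s := Finset.univ) (f := fun j => w j.1 (s j)), h3,
          Finset.prod_mul_distrib (g := fun k => F k (x0 (σ (k, 0))) (x0 (σ (k, 1))))]
        ring
      simp only [h2]
      rw [← Finset.mul_sum, ← Fintype.prod_sum (fun j b => w j.1 b * chi (σ.symm j).1 b),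
        ← Equiv.prod_comp σ, Fintype.prod_prod_type]
      simp only [G, S, id, Equiv.symm_apply_apply, Fin.prod_univ_two (M := ℂ)]
      rw [Finset.prod_mul_distrib]
      ring
    rw [h1]
    refine Finset.sum_eq_zero (fun s _ => ?_)
    rw [h _ (fun j => W.smul_mem _ (hu _)), mul_zero]
  have hS : ∀ k a, S k a = 0 ∨ (S k a = 2 ∧ k.isLeft = a.isLeft) := by
    rintro (k | k) (a | a) <;> simp [S, w, chi] <;> norm_num
  have hcJ : ∀ a b : Fin m × Fin 2, conj (J a b) = J a b := by
    intro a b; unfold J; split_ifs <;> simp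
  have hFJ : ∀ k a b, F k (x0 a) (x0 b) =
      J (Sum.elim id id a.1, a.2) (Sum.elim id id b.1, b.2) := by
    rintro (k | k) a b <;> simp [F, x0, hJ, hcJ]
  refine key_sum (fun k a b => G k a b / 4) ?_ ?_ ?_
  · rintro k ⟨a, s⟩ ⟨b, t⟩
    simp only [G, hFJ]
    rcases hS k a with h1 | ⟨h1, h1'⟩
    · left; simp [h1]
    rcases hS k b with h2 | ⟨h2, h2'⟩
    · left; simp [h2]
    right
    rw [h1, h2]
    have : a.isLeft = b.isLeft := h1'.symm.trans h2'
    rcases a with a | a <;> rcases b with b | b <;> simp [J] at this ⊢ <;>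
      split_ifs <;> norm_num
  · rintro (k | k) <;> simp [G, hFJ, J, S, w, chi] <;> norm_num
  · have : PS (fun k a b => G k a b / 4) id = (∏ k : Fin m ⊕ Fin m, (4 : ℂ)⁻¹) * PS G id := by
      simp only [PS, Finset.mul_sum, div_eq_mul_inv, Finset.prod_mul_distrib]
      refine Finset.sum_congr rfl (fun σ _ => ?_)
      ring
    rw [this, hGz, mul_zero]

end CoisoAux

/-- **Coisotropy via vanishing of `Ω^{n-p+1} ∧ Ω̄^{n-p+1}`.**  Let `Ω` be a
nondegenerate complex `(2,0)`-form on `ℂ^{2n}` and `W` a complex subspace of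
codimension `p ≤ n`.  Then the restriction of `Ω^{n-p+1} ∧ Ω̄^{n-p+1}` to `W` vanishes
iff the restriction of `Ω^{n-p+1}` to `W` vanishes, iff the rank of `Ω|_W` (the
dimension of `W` minus the dimension of the kernel of `Ω|_W`) is at most `2(n-p)`,
i.e. iff `W` is coisotropic. -/
theorem coisotropic_iff_power_vanishes (n p : ℕ) (hp : p ≤ n)
    (Ω : (Fin 2 → Vec (2 * n)) → ℂ)
    (hsmul : ∀ (v : Fin 2 → Vec (2 * n)) (i : Fin 2) (c : ℂ) (x : Vec (2 * n)),
      Ω (Function.update v i (c • x)) = c * Ω (Function.update v i x))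
    (hadd : ∀ (v : Fin 2 → Vec (2 * n)) (i : Fin 2) (x y : Vec (2 * n)),
      Ω (Function.update v i (x + y)) =
        Ω (Function.update v i x) + Ω (Function.update v i y))
    (halt : ∀ v : Fin 2 → Vec (2 * n), v 0 = v 1 → Ω v = 0)
    (hnd : ∀ x : Vec (2 * n), x ≠ 0 → ∃ y : Vec (2 * n), Ω ![x, y] ≠ 0)
    (W : Submodule ℂ (Vec (2 * n))) (hW : Module.finrank ℂ W = 2 * n - p)
    (Kw : Submodule ℂ (Vec (2 * n)))
    (hKw : ∀ v : Vec (2 * n), v ∈ Kw ↔ v ∈ W ∧ ∀ w ∈ W, Ω ![v, w] = 0) :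
    ((∀ v : Fin (2 * (2 * (n - p + 1))) → Vec (2 * n), (∀ j, v j ∈ W) →
        wedgeFam (2 * n) (2 * (n - p + 1))
          (fun k => if (k : ℕ) < n - p + 1 then Ω else fun w => conj (Ω w)) v = 0) ↔
      (∀ v : Fin (2 * (n - p + 1)) → Vec (2 * n), (∀ j, v j ∈ W) →
        wedgeFam (2 * n) (n - p + 1) (fun _ => Ω) v = 0)) ∧
    ((∀ v : Fin (2 * (n - p + 1)) → Vec (2 * n), (∀ j, v j ∈ W) →
        wedgeFam (2 * n) (n - p + 1) (fun _ => Ω) v = 0) ↔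
      Module.finrank ℂ W - Module.finrank ℂ Kw ≤ 2 * (n - p)) := by
  classical
  have u0 : ∀ a b z : Vec (2 * n), Function.update ![a, b] 0 z = ![z, b] := by
    intro a b z; ext i; fin_cases i <;> simp
  have u1 : ∀ a b z : Vec (2 * n), Function.update ![a, b] 1 z = ![a, z] := by
    intro a b z; ext i; fin_cases i <;> simp
  let B : Vec (2 * n) →ₗ[ℂ] Vec (2 * n) →ₗ[ℂ] ℂ := LinearMap.mk₂ ℂ (fun a b => Ω ![a, b])
    (fun a a' b => by have := hadd ![0, b] 0 a a'; simpa only [u0, smul_eq_mul] using this)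
    (fun c a b => by have := hsmul ![0, b] 0 c a; simpa only [u0, smul_eq_mul] using this)
    (fun a b b' => by have := hadd ![a, 0] 1 b b'; simpa only [u1, smul_eq_mul] using this)
    (fun c a b => by have := hsmul ![a, 0] 1 c b; simpa only [u1, smul_eq_mul] using this)
  have hBΩ : ∀ a b, Ω ![a, b] = B a b := fun a b => rfl
  have hB : ∀ a, B a a = 0 := fun a => halt _ rfl
  have hKB : ∀ v, v ∈ Kw ↔ v ∈ W ∧ ∀ w ∈ W, B v w = 0 := hKw
  set m := n - p + 1 with hm
  let ε : Fin m ⊕ Fin m ≃ Fin (2 * m) := finSumFinEquiv.trans (finCongr (two_mul m).symm)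
  have e1 := CoisoAux.wedgeFam_zero_iff (2 * n) (2 * m) ε
    (fun k => if (k : ℕ) < m then Ω else fun w => conj (Ω w)) (W : Set (Vec (2 * n)))
  have e2 := CoisoAux.wedgeFam_zero_iff (2 * n) m (Equiv.refl _)
    (fun _ => Ω) (W : Set (Vec (2 * n)))
  have hF : (fun (k : Fin m ⊕ Fin m) (x y : Vec (2 * n)) =>
      (if ((ε k : Fin (2 * m)) : ℕ) < m then Ω else fun w => conj (Ω w)) ![x, y]) =
      Sum.elim (fun _ => fun a b => B a b) (fun _ => fun a b => conj (B a b)) := by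
    funext k x y
    rcases k with k | k <;> simp [ε, hBΩ]
  simp only [SetLike.mem_coe] at e1 e2
  rw [hF] at e1
  simp only [hBΩ] at e2
  rw [e1, e2]
  have hsymp : ¬ (Module.finrank ℂ W - Module.finrank ℂ Kw ≤ 2 * (n - p)) →
      ∃ u : Fin m × Fin 2 → Vec (2 * n), (∀ j, u j ∈ W) ∧
        ∀ a b, B (u a) (u b) = CoisoAux.J a b := by
    intro h
    exact CoisoAux.exists_sympl B hB m W Kw hKB (by omega)
  have hrank : (Module.finrank ℂ W - Module.finrank ℂ Kw ≤ 2 * (n - p)) →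
      ∀ x : Fin m × Fin 2 → Vec (2 * n), (∀ j, x j ∈ W) →
        CoisoAux.PS (fun _ : Fin m => fun a b => B a b) x = 0 := by
    intro h x hx
    exact CoisoAux.PS_zero_of_rank B hB W Kw hKB (by omega) x hx
  refine ⟨⟨fun h => ?_, fun h x hx => ?_⟩, ⟨fun h => ?_, hrank⟩⟩
  · apply hrank
    by_contra hc
    obtain ⟨u, hu, hJ⟩ := hsymp hc
    exact CoisoAux.double_nonzero B W u hu hJ h
  · exact CoisoAux.half_zero _ _ (W : Set (Vec (2 * n))) h x hx
  · by_contra hc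
    obtain ⟨u, hu, hJ⟩ := hsymp hc
    refine CoisoAux.key_sum (fun _ : Fin m => CoisoAux.J) (fun _ _ _ => Or.inr rfl)
      (fun k => by simp [CoisoAux.J]) ?_
    have := h u hu
    simpa only [CoisoAux.PS, hJ, id] using this
end
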